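/- 1546463 divides the class number of the compositum ℚ(2)·ℚ(1546463) = ℚ(√2)·ℚ(1546463), a totally real abelian field of degree 2·1546463 over ℚ; equivalently, the 1546463-class group of ℚ(2)·ℚ(1546463) is nontrivial. -/

import Mathlib

open NumberField

/-- Ideals of `ℚ(ζ_n)` prime to `n` have absolute norm congruent to `1` modulo `n`. -/
theorem IsCyclotomicExtension.absNorm_modEq_one (n : ℕ) [NeZero n] (C : Type*) [Field C]
    [NumberField C] [IsCyclotomicExtension {n} ℚ C] (I : Ideal (𝓞 C))
    (hI : (Ideal.absNorm I).Coprime n) : Ideal.absNorm I ≡ 1 [MOD n] := by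
  induction I using UniqueFactorizationMonoid.induction_on_prime with
  | h₁ =>
    have : n = 1 := by simpa using hI
    subst this
    exact Nat.modEq_one
  | h₂ I hI =>
    rw [Ideal.isUnit_iff.mp ‹IsUnit I›, Ideal.absNorm_top]
  | h₃ J P hJ hP ih =>
    rw [map_mul] at hI ⊢
    refine Nat.ModEq.mul (b := 1) (d := 1) ?_ (ih (Nat.Coprime.coprime_mul_left hI))
    have hPc := Nat.Coprime.coprime_mul_right hI
    have : P.IsPrime := Ideal.isPrime_of_prime hP
    have : P.IsMaximal := this.isMaximal hP.ne_zero
    let := Ideal.Quotient.field P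
    have : Finite (𝓞 C ⧸ P) := Ideal.finiteQuotientOfFreeOfNeBot P hP.ne_zero
    have hn : NeZero (n : 𝓞 C ⧸ P) := by
      refine ⟨fun h0 ↦ ?_⟩
      have h1 : (Ideal.absNorm P : 𝓞 C ⧸ P) = 0 := by
        rw [← map_natCast (Ideal.Quotient.mk P)]
        exact Ideal.Quotient.eq_zero_iff_mem.mpr (Ideal.absNorm_mem P)
      have h2 := (Nat.isCoprime_iff_coprime.mpr hPc).map (Int.castRingHom (𝓞 C ⧸ P))
      simp [h0, h1] at h2
    have hζ := (IsCyclotomicExtension.zeta_spec n ℚ C).toInteger_isPrimitiveRoot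
    have hroot : (Polynomial.cyclotomic n (𝓞 C ⧸ P)).IsRoot
        (Ideal.Quotient.mk P (IsCyclotomicExtension.zeta_spec n ℚ C).toInteger) := by
      have := (hζ.isRoot_cyclotomic (NeZero.pos n)).map (f := Ideal.Quotient.mk P)
      rwa [Polynomial.map_cyclotomic] at this
    have hprim := Polynomial.isRoot_cyclotomic_iff.mp hroot
    have hdvd : n ∣ Nat.card (𝓞 C ⧸ P) - 1 := by
      rw [← Nat.card_units]
      obtain ⟨u, hu⟩ := hprim.isUnit (NeZero.ne n)
      rw [← hu, IsPrimitiveRoot.coe_units_iff] at hprim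
      rw [hprim.eq_orderOf]
      exact orderOf_dvd_natCard u
    rw [Ideal.absNorm_apply, Submodule.cardQuot_apply]
    exact ((Nat.modEq_iff_dvd' Nat.card_pos).mpr hdvd).symm

theorem finrank_eq_sub_one_of_isCyclotomicExtension {p : ℕ} [Fact p.Prime] {F C : Type*} [Field F]
    [Field C] [NumberField F] [NumberField C] [Algebra F C] [IsCyclotomicExtension {p ^ 2} ℚ C]
    (hF : Module.finrank ℚ F = p) : Module.finrank F C = p - 1 := by
  have hp : p.Prime := Fact.out
  have h := Module.finrank_mul_finrank ℚ F C
  rw [IsCyclotomicExtension.finrank (n := p ^ 2) C (Polynomial.cyclotomic.irreducible_rat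
    (pow_pos hp.pos 2)), Nat.totient_prime_pow hp two_pos, hF] at h
  simpa using Nat.eq_of_mul_eq_mul_left hp.pos (h.trans (by ring))

/-- If `F` is the degree `p` subfield of `ℚ(ζ_{p²})` and `x : 𝓞 F` has norm prime to `p`, then the
`(p - 1)`-st power of the norm of `x` is congruent to `1` modulo `p ^ 2`. -/
theorem norm_pow_modEq_one {p : ℕ} [Fact p.Prime] (hp : p ≠ 2) {F C : Type*} [Field F] [Field C]
    [NumberField F] [NumberField C] [Algebra F C] [IsCyclotomicExtension {p ^ 2} ℚ C]
    (hF : Module.finrank ℚ F = p) (x : 𝓞 F) (hx : IsCoprime (Algebra.norm ℤ x) p) :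
    Algebra.norm ℤ x ^ (p - 1) ≡ 1 [ZMOD (p ^ 2 : ℕ)] := by
  have hnorm : Algebra.norm ℤ (algebraMap (𝓞 F) (𝓞 C) x) = Algebra.norm ℤ x ^ (p - 1) := by
    apply Int.cast_injective (α := ℚ)
    push_cast
    rw [Algebra.coe_norm_int, Algebra.coe_norm_int, ← Algebra.norm_norm (S := F),
      ← finrank_eq_sub_one_of_isCyclotomicExtension (C := C) hF, ← map_pow,
      ← Algebra.norm_algebraMap]
    rfl
  have heven : Even (p - 1) := (Fact.out : p.Prime).even_sub_one hp
  have habs : (Ideal.absNorm (Ideal.span {algebraMap (𝓞 F) (𝓞 C) x}) : ℤ) =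
      Algebra.norm ℤ x ^ (p - 1) := by
    rw [Ideal.absNorm_span_singleton, hnorm, Int.natCast_natAbs, abs_of_nonneg (heven.pow_nonneg _)]
  have := IsCyclotomicExtension.absNorm_modEq_one (p ^ 2) C
    (Ideal.span {algebraMap (𝓞 F) (𝓞 C) x}) (by
      rw [← Nat.isCoprime_iff_coprime, habs]
      push_cast
      exact hx.pow)
  rw [← Int.natCast_modEq_iff, habs] at this
  exact_mod_cast this

/-- The prime `p` is totally and principally ramified in the degree `p` subfield of `ℚ(ζ_{p²})`. -/
theorem exists_pow_associated {p : ℕ} [Fact p.Prime] {F C : Type*} [Field F] [Field C]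
    [NumberField F] [NumberField C] [Algebra F C] [IsCyclotomicExtension {p ^ 2} ℚ C]
    (hF : Module.finrank ℚ F = p) : ∃ x : 𝓞 F, Associated (x ^ p) (p : 𝓞 F) := by
  have hp1 : p - 1 ≠ 0 := Nat.sub_ne_zero_of_lt (Fact.out : p.Prime).one_lt
  have hζ := IsCyclotomicExtension.zeta_spec (p ^ 2) ℚ C
  have : IsCyclotomicExtension {p ^ (1 + 1)} ℚ C := ‹_›
  have h := IsCyclotomicExtension.Rat.map_eq_span_zeta_sub_one_pow p 1 (hζ := hζ)
  rw [Ideal.map_span, Set.image_singleton, Ideal.span_singleton_pow,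
    Ideal.span_singleton_eq_span_singleton] at h
  refine ⟨RingOfIntegers.norm F (hζ.toInteger - 1), ?_⟩
  rw [← Associated.pow_iff hp1]
  have h2 := h.symm.map (RingOfIntegers.norm F)
  have hFC := finrank_eq_sub_one_of_isCyclotomicExtension (C := C) hF
  have h3 := RingOfIntegers.norm_algebraMap (L := C) F (p : 𝓞 F)
  rw [hFC, map_natCast] at h3
  rw [← Module.finrank_mul_finrank ℚ F C, hFC, hF, pow_mul, map_pow, map_pow] at h2
  simpa [h3] using h2


theorem linearIndependent_pair_one {F E : Type*} [Field F] [Field E] [Algebra F E] {s : E}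
    (hs : s ∉ Set.range (algebraMap F E)) : LinearIndependent F ![1, s] := by
  rw [LinearIndependent.pair_iff' one_ne_zero]
  intro a ha
  exact hs ⟨a, by rw [← ha, Algebra.smul_def, mul_one]⟩

theorem Algebra.trace_eq_zero_of_sq_eq {F E : Type*} [Field F] [Field E] [Algebra F E]
    (hFE : Module.finrank F E = 2) {s : E} {d : F} (hs : s ^ 2 = algebraMap F E d)
    (hsF : s ∉ Set.range (algebraMap F E)) : Algebra.trace F E s = 0 := by
  have : FiniteDimensional F E := Module.finite_of_finrank_pos (by omega)
  let b := basisOfLinearIndependentOfCardEqFinrank (linearIndependent_pair_one hsF) (by simp [hFE])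
  have hb0 : b 0 = 1 := by simp [b]
  have hb1 : b 1 = s := by simp [b]
  have h0 : s * b 0 = b 1 := by rw [hb0, hb1, mul_one]
  have h1 : s * b 1 = d • b 0 := by rw [hb0, hb1, ← sq, hs, Algebra.smul_def, mul_one]
  rw [Algebra.trace_eq_matrix_trace b, Matrix.trace_fin_two, Algebra.leftMulMatrix_eq_repr_mul,
    Algebra.leftMulMatrix_eq_repr_mul, h0, h1, map_smul]
  simp

theorem four_mul_eq_trace_add {F E : Type*} [Field F] [Field E] [Algebra F E]
    (hFE : Module.finrank F E = 2) {s : E} (hs : s ^ 2 = 2)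
    (hsF : s ∉ Set.range (algebraMap F E)) (x : E) :
    4 * x = 2 * algebraMap F E (Algebra.trace F E x) +
      s * algebraMap F E (Algebra.trace F E (s * x)) := by
  have : FiniteDimensional F E := Module.finite_of_finrank_pos (by omega)
  have htr := Algebra.trace_eq_zero_of_sq_eq hFE (d := 2) (by rw [hs, map_ofNat]) hsF
  obtain ⟨a, b, rfl⟩ : ∃ a b : F, algebraMap F E a + algebraMap F E b * s = x := by
    have htop := (linearIndependent_pair_one hsF).span_eq_top_of_card_eq_finrank' (by simp [hFE])
    have hx : x ∈ Submodule.span F (Set.range ![1, s]) := htop ▸ Submodule.mem_top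
    simp only [Matrix.range_cons, Matrix.range_empty, Set.union_empty, Set.singleton_union,
      Submodule.mem_span_pair, Algebra.smul_def, mul_one] at hx
    exact hx
  have h1 : Algebra.trace F E (algebraMap F E a + algebraMap F E b * s) = 2 * a := by
    rw [map_add, Algebra.trace_algebraMap, ← Algebra.smul_def, map_smul, htr, hFE]
    simp
  have h2 : Algebra.trace F E (s * (algebraMap F E a + algebraMap F E b * s)) = 4 * b := by
    have : s * (algebraMap F E a + algebraMap F E b * s) = a • s + algebraMap F E (2 * b) := by
      rw [Algebra.smul_def, map_mul, map_ofNat]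
      linear_combination algebraMap F E b * hs
    rw [this, map_add, Algebra.trace_algebraMap, map_smul, htr, hFE]
    simp
    ring
  rw [h1, h2]
  simp only [map_mul, map_ofNat]
  ring

/-- The squares of units of `ℤ[√2]` are up to sign powers of `3 + 2√2`, so they are controlled by the
image of `3 + 2√2` under any ring homomorphism. -/
theorem Zsqrtd.map_pow_eq_one_of_isUnit {R : Type*} [CommRing R] (φ : ℤ√2 →+* R) {m : ℕ}
    (hm : Even m) (hφ : φ ⟨3, 2⟩ ^ m = 1) {z : ℤ√2} (hz : IsUnit z) : φ z ^ (2 * m) = 1 := by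
  have hnorm : z.norm ^ 2 = 1 := by
    rw [← Int.natAbs_sq, Zsqrtd.norm_eq_one_iff.mpr hz]
    rfl
  let a : Pell.Solution₁ 2 := Pell.Solution₁.mk 3 2 (by norm_num)
  have hfund : Pell.IsFundamental a := by
    refine ⟨by simp [a], by simp [a], fun {b} hb ↦ ?_⟩
    simp only [a, Pell.Solution₁.x_mk]
    by_contra! hlt
    have : b.x = 2 := by omega
    have := b.prop_y
    simp_all
    omega
  let b : Pell.Solution₁ 2 := ⟨z ^ 2, by
    rw [← Zsqrtd.norm_eq_one_iff_mem_unitary, ← hnorm, sq, Zsqrtd.norm_mul, sq]⟩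
  let f : Pell.Solution₁ 2 →* R := (φ : ℤ√2 →* R).comp (unitary (ℤ√2)).subtype
  have hfa : f a ^ m = 1 := hφ
  have hfb : f b = φ z ^ 2 := map_pow φ z 2
  rw [pow_mul, ← hfb, ← map_pow]
  have hpow (k : ℤ) : f ((a ^ k) ^ m) = 1 := by
    have h1 : f.toHomUnits a ^ m = 1 := Units.ext hfa
    have h2 : f.toHomUnits ((a ^ k) ^ m) = 1 := by
      rw [map_pow, map_zpow, ← zpow_natCast, zpow_comm, zpow_natCast, h1, one_zpow]
    exact congrArg Units.val h2
  obtain ⟨k, hk | hk⟩ := hfund.eq_zpow_or_neg_zpow b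
  · rw [hk, hpow]
  · rw [hk, hm.neg_pow, hpow]

theorem exists_ringOfIntegers_four_mul_eq {F E : Type*} [Field F] [Field E] [CharZero E]
    [Algebra F E] (hFE : Module.finrank F E = 2) {s : E} (hs : s ^ 2 = 2)
    (hsF : s ∉ Set.range (algebraMap F E)) (x : 𝓞 E) :
    ∃ a b : 𝓞 F, (4 * x : E) = 2 * algebraMap F E a + s * algebraMap F E b := by
  have : FiniteDimensional F E := Module.finite_of_finrank_pos (by omega)
  have hs' : IsIntegral ℤ s := .of_pow two_pos (by
    simpa [hs] using isIntegral_algebraMap (R := ℤ) (A := E) (x := 2))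
  exact ⟨⟨_, Algebra.isIntegral_trace x.isIntegral_coe⟩,
    ⟨_, Algebra.isIntegral_trace (hs'.mul x.isIntegral_coe)⟩, four_mul_eq_trace_add hFE hs hsF _⟩

theorem notMem_range_algebraMap_rat_of_sq_eq_two {E : Type*} [Field E] [CharZero E] {s : E}
    (hs : s ^ 2 = 2) : s ∉ Set.range (algebraMap ℚ E) := by
  rintro ⟨q, rfl⟩
  have hq : q ^ 2 = 2 := (algebraMap ℚ E).injective (by simpa using hs)
  refine irrational_sqrt_two ⟨|q|, ?_⟩
  rw [eq_comm, Real.sqrt_eq_iff_mul_self_eq (by norm_num) (by positivity), ← Rat.cast_mul,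
    abs_mul_abs_self, ← sq, hq, Rat.cast_ofNat]

theorem finrank_adjoin_eq_two_of_sq_eq_two {E : Type*} [Field E] [CharZero E] {s : E}
    (hs : s ^ 2 = 2) : Module.finrank ℚ (IntermediateField.adjoin ℚ {s}) = 2 := by
  have hmonic : (Polynomial.X ^ 2 - Polynomial.C 2 : Polynomial ℚ).Monic :=
    Polynomial.monic_X_pow_sub_C 2 two_ne_zero
  have hroot : Polynomial.aeval s (Polynomial.X ^ 2 - Polynomial.C 2 : Polynomial ℚ) = 0 := by
    simp [hs]
  have hint : IsIntegral ℚ s := ⟨_, hmonic, hroot⟩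
  have hle := Polynomial.natDegree_le_of_dvd (minpoly.dvd ℚ s hroot) hmonic.ne_zero
  rw [Polynomial.natDegree_X_pow_sub_C] at hle
  have hne : (minpoly ℚ s).natDegree ≠ 1 := by
    rw [Ne, minpoly.natDegree_eq_one_iff]
    exact notMem_range_algebraMap_rat_of_sq_eq_two hs
  have hpos := minpoly.natDegree_pos hint
  rw [IntermediateField.adjoin.finrank hint]
  omega

section Quadratic

variable {K : Type*} [Field K] [NumberField K] {s : 𝓞 K}

theorem trace_int_eq_zero_of_sq_eq_two (hK : Module.finrank ℚ K = 2)
    (hs : s * s = ((2 : ℤ) : 𝓞 K)) : Algebra.trace ℤ (𝓞 K) s = 0 := by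
  have hs2 : (s : K) ^ 2 = 2 := by
    rw [sq, ← map_mul, hs, map_intCast, Int.cast_ofNat]
  apply Int.cast_injective (α := ℚ)
  rw [Algebra.coe_trace_int, Int.cast_zero]
  exact Algebra.trace_eq_zero_of_sq_eq hK (d := 2) (by simpa using hs2)
    (notMem_range_algebraMap_rat_of_sq_eq_two hs2)

theorem Zsqrtd.trace_lift (hK : Module.finrank ℚ K = 2) (hs : s * s = ((2 : ℤ) : 𝓞 K))
    (z : ℤ√2) : Algebra.trace ℤ (𝓞 K) (Zsqrtd.lift ⟨s, hs⟩ z) = 2 * z.re := by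
  have h1 : Algebra.trace ℤ (𝓞 K) (z.re : 𝓞 K) = 2 * z.re := by
    simpa [RingOfIntegers.rank, hK] using Algebra.trace_algebraMap (S := 𝓞 K) z.re
  have h2 : Algebra.trace ℤ (𝓞 K) (z.im * s) = 0 := by
    rw [← zsmul_eq_mul, map_zsmul, trace_int_eq_zero_of_sq_eq_two hK hs, smul_zero]
  rw [Zsqrtd.lift_apply_apply, map_add, h1, h2, add_zero]

theorem Zsqrtd.dvd_of_lift_eq_mul (hK : Module.finrank ℚ K = 2) (hs : s * s = ((2 : ℤ) : 𝓞 K))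
    {n : ℤ} (hn : IsCoprime n 2) {z : ℤ√2} {c : 𝓞 K} (h : Zsqrtd.lift ⟨s, hs⟩ z = n * c) :
    n ∣ z.re ∧ n ∣ z.im := by
  have key {w : ℤ√2} {d : 𝓞 K} (h : Zsqrtd.lift ⟨s, hs⟩ w = n * d) : n ∣ w.re := by
    refine hn.dvd_of_dvd_mul_left ⟨Algebra.trace ℤ (𝓞 K) d, ?_⟩
    rw [← Zsqrtd.trace_lift hK hs, h, ← zsmul_eq_mul, map_zsmul, smul_eq_mul]
  refine ⟨key h, hn.dvd_of_dvd_mul_left ?_⟩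
  have h2 := key (w := z * ⟨0, 1⟩) (d := c * s) (by
    rw [map_mul, h]
    simp [mul_assoc])
  simpa using h2

theorem four_mul_eq_lift (hK : Module.finrank ℚ K = 2) (hs : s * s = ((2 : ℤ) : 𝓞 K)) (v : 𝓞 K) :
    ∃ a b : ℤ, 4 * v = Zsqrtd.lift ⟨s, hs⟩ ⟨2 * a, b⟩ := by
  have hs2 : (s : K) ^ 2 = 2 := by
    rw [sq, ← map_mul, hs, map_intCast, Int.cast_ofNat]
  refine ⟨Algebra.trace ℤ (𝓞 K) v, Algebra.trace ℤ (𝓞 K) (s * v), ?_⟩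
  apply RingOfIntegers.ext
  have h := four_mul_eq_trace_add hK hs2 (notMem_range_algebraMap_rat_of_sq_eq_two hs2) (v : K)
  have h1 := Algebra.coe_trace_int v
  have h2 := Algebra.coe_trace_int (s * v)
  rw [show ((s * v : 𝓞 K) : K) = s * v from map_mul _ _ _] at h2
  rw [← h1, ← h2] at h
  have h3 : algebraMap (𝓞 K) K 4 = 4 := map_ofNat _ 4
  have h4 : algebraMap (𝓞 K) K 2 = 2 := map_ofNat _ 2
  simpa [Zsqrtd.lift_apply_apply, h3, h4, mul_comm] using h

theorem Int.dvd_of_cast_dvd_ringOfIntegers {m n : ℤ} (h : (m : 𝓞 K) ∣ n) : m ∣ n := by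
  obtain ⟨c, hc⟩ := h
  have hnorm := congrArg (Algebra.norm ℤ) hc
  rw [map_mul, ← eq_intCast (algebraMap ℤ (𝓞 K)), ← eq_intCast (algebraMap ℤ (𝓞 K)),
    Algebra.norm_algebraMap, Algebra.norm_algebraMap] at hnorm
  refine (Int.pow_dvd_pow_iff (n := Module.finrank ℤ (𝓞 K)) ?_).mp ⟨_, hnorm⟩
  rw [RingOfIntegers.rank]
  exact Nat.ne_of_gt Module.finrank_pos

/-- Every unit of the ring of integers of `ℚ(√2)` comes from a unit of `ℤ[√2]`. -/
theorem Zsqrtd.exists_isUnit_lift_eq (hK : Module.finrank ℚ K = 2)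
    (hs : s * s = ((2 : ℤ) : 𝓞 K)) (v : (𝓞 K)ˣ) :
    ∃ z : ℤ√2, IsUnit z ∧ Zsqrtd.lift ⟨s, hs⟩ z = v := by
  have hdvd {v : 𝓞 K} {a b : ℤ} (h : 4 * v = Zsqrtd.lift ⟨s, hs⟩ ⟨2 * a, b⟩) :
      8 ∣ 2 * a ^ 2 - b ^ 2 := by
    rw [← mul_dvd_mul_iff_left (two_ne_zero (α := ℤ))]
    refine Int.dvd_of_cast_dvd_ringOfIntegers (K := K) ⟨v * (a - v), ?_⟩
    simp only [Zsqrtd.lift_apply_apply] at h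
    push_cast at h hs ⊢
    linear_combination (4 * v + 2 * a + b * s - a * 4) * h + b ^ 2 * hs
  obtain ⟨a, b, hab⟩ := four_mul_eq_lift hK hs v
  obtain ⟨c, d, hcd⟩ := four_mul_eq_lift hK hs (v⁻¹ : (𝓞 K)ˣ)
  have hmul : (⟨2 * a, b⟩ * ⟨2 * c, d⟩ : ℤ√2) = 16 := by
    apply Zsqrtd.lift_injective (R := 𝓞 K) ⟨s, hs⟩ (fun n hn ↦ ?_)
    · rw [map_mul, ← hab, ← hcd, map_ofNat]
      linear_combination 16 * v.mul_inv
    · have : n < 2 := by nlinarith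
      have : -2 < n := by nlinarith
      interval_cases n <;> omega
  obtain ⟨m, hm⟩ := hdvd hab
  obtain ⟨n, hn⟩ := hdvd hcd
  have hnm : m * n = 1 := by
    have := congrArg Zsqrtd.norm hmul
    rw [Zsqrtd.norm_mul, show (16 : ℤ√2) = ((16 : ℤ) : ℤ√2) by simp, Zsqrtd.norm_intCast,
      Zsqrtd.norm_def, Zsqrtd.norm_def] at this
    nlinarith
  have hm1 : m = 1 ∨ m = -1 := Int.eq_one_or_neg_one_of_mul_eq_one hnm
  obtain ⟨b, rfl⟩ : 2 ∣ b := by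
    refine Int.prime_two.dvd_of_dvd_pow (n := 2) ⟨a ^ 2 - 4 * m, by linarith⟩
  obtain ⟨a, rfl⟩ : 2 ∣ a := by
    refine Int.prime_two.dvd_of_dvd_pow (n := 2) ⟨b ^ 2 + 2 * m, by linarith⟩
  obtain ⟨b, rfl⟩ : 2 ∣ b := by
    refine Int.prime_two.dvd_of_dvd_pow (n := 2) ⟨a ^ 2 - m, by linarith⟩
  refine ⟨⟨a, b⟩, ?_, ?_⟩
  · rw [← Zsqrtd.norm_eq_one_iff, Zsqrtd.norm_def, Int.natAbs_eq_iff]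
    rcases hm1 with rfl | rfl
    · left; push_cast; linarith
    · right; push_cast; linarith
  · apply mul_left_cancel₀ (OfNat.ofNat_ne_zero 4 : (4 : 𝓞 K) ≠ 0)
    rw [hab]
    simp only [Zsqrtd.lift_apply_apply]
    push_cast
    ring

/-- If `√2 - r` divides `z - m` in the algebraic integers, where `r ^ 2 ≡ 2` modulo `n` and `n` is
odd, then `n` divides `z` evaluated at `√2 = r`, minus `m`. -/
theorem Zsqrtd.dvd_of_lift_sub_eq_mul (hK : Module.finrank ℚ K = 2)
    (hs : s * s = ((2 : ℤ) : 𝓞 K)) {n r m : ℤ} (hn : IsCoprime n 2) (hr : n ∣ r ^ 2 - 2) {z : ℤ√2}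
    {Ω : Type*} [Field Ω] [Algebra K Ω] {c : Ω} (hc : IsIntegral ℤ c)
    (h : algebraMap K Ω (Zsqrtd.lift ⟨s, hs⟩ z : 𝓞 K) - m = (algebraMap K Ω s - r) * c) :
    n ∣ z.re + r * z.im - m := by
  have : CharZero Ω := charZero_of_injective_algebraMap (algebraMap K Ω).injective
  obtain ⟨k, hk⟩ := hr
  have hkΩ : (r : Ω) ^ 2 - 2 = n * k := by
    simpa using congrArg (Int.cast (R := Ω)) hk
  have hs2 : (s : K) ^ 2 = 2 := by
    rw [sq, ← map_mul, hs, map_intCast, Int.cast_ofNat]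
  have hsΩ : algebraMap K Ω s ^ 2 = 2 := by
    rw [← map_pow, hs2, map_ofNat]
  have hn0 : n ≠ 0 := by
    rintro rfl
    simp [isCoprime_zero_left, Int.isUnit_iff] at hn
  have hnK : (n : K) ≠ 0 := Int.cast_ne_zero.mpr hn0
  have hnΩ : (n : Ω) ≠ 0 := Int.cast_ne_zero.mpr hn0
  let e : K := (r + s) * ((Zsqrtd.lift ⟨s, hs⟩ z : 𝓞 K) - m) / n
  have heΩ : algebraMap K Ω e = -(k * c) := by
    simp only [e, map_div₀, map_mul, map_sub, map_add, map_intCast, h]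
    field_simp
    linear_combination c * hsΩ - c * hkΩ
  have he : IsIntegral ℤ e := by
    rw [← isIntegral_algebraMap_iff (algebraMap K Ω).injective, heΩ]
    exact (by simpa using isIntegral_algebraMap (R := ℤ) (A := Ω) (x := k) : IsIntegral ℤ (k : Ω))
      |>.mul hc |>.neg
  obtain ⟨E, hE⟩ : ∃ E : 𝓞 K, algebraMap (𝓞 K) K E = e := ⟨⟨e, he⟩, rfl⟩
  have hdvd : Zsqrtd.lift ⟨s, hs⟩ (⟨r, 1⟩ * (z - (m : ℤ√2))) = n * E := by
    apply RingOfIntegers.ext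
    have hr1 : Zsqrtd.lift ⟨s, hs⟩ ⟨r, 1⟩ = r + s := by simp [Zsqrtd.lift_apply_apply]
    rw [map_mul, map_sub, hr1, map_intCast]
    change algebraMap (𝓞 K) K _ = algebraMap (𝓞 K) K _
    rw [map_mul, map_mul, map_intCast, hE, mul_div_cancel₀ _ hnK, map_add, map_sub, map_intCast,
      map_intCast]
  have := (Zsqrtd.dvd_of_lift_eq_mul hK hs hn hdvd).2
  simp only [Zsqrtd.im_mul, Zsqrtd.re_sub, Zsqrtd.im_sub, Zsqrtd.re_intCast,
    Zsqrtd.im_intCast] at this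
  convert this using 1
  ring

end Quadratic

theorem finrank_eq_of_sup_eq_top {k L : Type*} [Field k] [Field L] [Algebra k L]
    [FiniteDimensional k L] {K F : IntermediateField k L} (hKF : K ⊔ F = ⊤)
    (h : K.LinearDisjoint F) : Module.finrank F L = Module.finrank k K := by
  have h1 := h.finrank_sup
  rw [hKF, IntermediateField.finrank_top', ← Module.finrank_mul_finrank k F L, mul_comm] at h1
  exact Nat.eq_of_mul_eq_mul_right Module.finrank_pos h1

/-- A divisor of all conjugates of `x - y` divides the difference of the products of conjugates. -/
theorem prod_embeddings_sub_mem {K L Ω : Type*} [Field K] [Field L] [Field Ω] [Algebra K L]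
    [Algebra K Ω] [Fintype (L →ₐ[K] Ω)] {x y : 𝓞 L} {d : 𝓞 Ω}
    (h : ∀ σ : L →ₐ[K] Ω, ∃ c : 𝓞 Ω, σ x - σ y = d * c) :
    ∃ c : 𝓞 Ω, ∏ σ : L →ₐ[K] Ω, σ x - ∏ σ : L →ₐ[K] Ω, σ y = d * c := by
  let f (z : 𝓞 L) (σ : L →ₐ[K] Ω) : 𝓞 Ω := ⟨σ z, map_isIntegral_int σ.toRingHom z.isIntegral_coe⟩
  have hd : d ∣ ∏ σ, f x σ - ∏ σ, f y σ := by
    rw [← Ideal.mem_span_singleton, ← Ideal.Quotient.eq, map_prod, map_prod]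
    refine Finset.prod_congr rfl fun σ _ ↦ ?_
    rw [Ideal.Quotient.eq, Ideal.mem_span_singleton]
    obtain ⟨c, hc⟩ := h σ
    exact ⟨c, RingOfIntegers.ext hc⟩
  obtain ⟨c, hc⟩ := hd
  refine ⟨c, ?_⟩
  have := congrArg (algebraMap (𝓞 Ω) Ω) hc
  rwa [map_sub, map_prod, map_prod, map_mul] at this

/-- Let `L` be the compositum of `K = ℚ(√2)` and a field `F` of odd degree, and let `r` be a square
root of `2` modulo `n`. The norm to `K` of an element of `4 𝓞 L`, evaluated at `√2 = r`, is congruent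
modulo `n` to the norm of an element of `𝓞 F`. -/
theorem exists_norm_intCast_congr {L : Type*} [Field L] [NumberField L] (K F : IntermediateField ℚ L)
    (hKF : K ⊔ F = ⊤) (hK : Module.finrank ℚ K = 2) (hF : Odd (Module.finrank ℚ F)) {s : 𝓞 K}
    (hs : s * s = ((2 : ℤ) : 𝓞 K)) {n r : ℤ} (hn : IsCoprime n 2) (hr : n ∣ r ^ 2 - 2) (x : 𝓞 L)
    (z : ℤ√2) (hz : RingOfIntegers.norm K (4 * x) = Zsqrtd.lift ⟨s, hs⟩ z) :
    ∃ y : 𝓞 F, n ∣ z.re + r * z.im - Algebra.norm ℤ y := by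
  have hdisj : K.LinearDisjoint F := .of_finrank_coprime (by
    rw [hK]
    exact hF.coprime_two_left)
  have hFL : Module.finrank F L = 2 := (finrank_eq_of_sup_eq_top hKF hdisj).trans hK
  have hs2 : (s : K) ^ 2 = 2 := by
    rw [sq, ← map_mul, hs, map_intCast, Int.cast_ofNat]
  have hsL : ((s : K) : L) ^ 2 = 2 := congrArg (algebraMap K L) hs2
  have hsF : ((s : K) : L) ∉ Set.range (algebraMap F L) := by
    rintro ⟨t, ht⟩
    have hmem : ((s : K) : L) ∈ K ⊓ F := ⟨(s : K).2, ht ▸ t.2⟩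
    rw [hdisj.inf_eq_bot, IntermediateField.mem_bot] at hmem
    exact notMem_range_algebraMap_rat_of_sq_eq_two hsL hmem
  obtain ⟨a, b, hab⟩ := exists_ringOfIntegers_four_mul_eq hFL hsL hsF x
  let y : 𝓞 F := 2 * a + r * b
  let yL : 𝓞 L := algebraMap (𝓞 F) (𝓞 L) y
  refine ⟨y, ?_⟩
  let Ω := AlgebraicClosure K
  let sΩ : 𝓞 Ω := algebraMap (𝓞 K) (𝓞 Ω) s
  have hsΩ : (sΩ : Ω) = algebraMap K Ω s := rfl
  obtain ⟨c, hc⟩ := prod_embeddings_sub_mem (K := K) (Ω := Ω) (x := 4 * x) (y := yL)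
    (d := sΩ - r) fun σ ↦ by
      refine ⟨⟨σ (algebraMap F L b),
        map_isIntegral_int (σ.toRingHom.comp (algebraMap F L)) b.isIntegral_coe⟩, ?_⟩
      have hσs : σ (s : K) = algebraMap K Ω s := σ.commutes s
      have hx : ((4 * x : 𝓞 L) : L) = 4 * x := by
        change algebraMap (𝓞 L) L (4 * x) = _
        rw [map_mul, map_ofNat]
      have hy : (yL : L) = 2 * algebraMap F L a + r * algebraMap F L b := by
        change algebraMap F L y = _
        simp only [y, map_add, map_mul (algebraMap (𝓞 F) F), map_mul (algebraMap F L), map_intCast]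
        rw [map_ofNat (algebraMap (𝓞 F) F), map_ofNat]
      rw [hx, hab, hy]
      simp [hσs, hsΩ]
      ring
  have hy : Algebra.norm K (yL : L) = (Algebra.norm ℤ y : ℤ) := by
    have hyQ : Algebra.norm ℚ (y : F) = (Algebra.norm ℤ y : ℤ) := by
      rw [Algebra.coe_norm_int]
    rw [show (yL : L) = algebraMap F L y from rfl, hdisj.norm_algebraMap hKF]
    erw [hyQ]
    simp
  have hd : ((sΩ - r : 𝓞 Ω) : Ω) = algebraMap K Ω s - r := by
    change algebraMap (𝓞 Ω) Ω (sΩ - r) = _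
    rw [map_sub, map_intCast]
    rfl
  refine Zsqrtd.dvd_of_lift_sub_eq_mul hK hs hn hr (Ω := Ω) c.isIntegral_coe ?_
  rw [← Algebra.norm_eq_prod_embeddings, ← Algebra.norm_eq_prod_embeddings, hy, map_intCast,
    hd] at hc
  rw [← hz]
  exact hc

/-- Let `L` be the compositum of `K = ℚ(√2)` and the degree `p` subfield `F` of `ℚ(ζ_{p²})`, and let
`r` be a square root of `2` modulo `p ^ 2`. If `(3 + 2r) ^ (p - 1) = 1` modulo `p ^ 2`, while the same
fails for the square of `x + y * r` where `x + y√2` has norm `p`, then `p` divides the class number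
of `L`: otherwise the ideal whose `p`-th power is generated by `x + y√2` is principal, and the norm
to `K` of a generator contradicts the congruence for norms from `F`. -/
theorem dvd_card_classGroup {p : ℕ} [Fact p.Prime] (hp : p ≠ 2) {L C : Type*} [Field L]
    [NumberField L] (K F : IntermediateField ℚ L) (hKF : K ⊔ F = ⊤) (hK : Module.finrank ℚ K = 2)
    (hF : Module.finrank ℚ F = p) [Field C] [NumberField C] [Algebra F C]
    [IsCyclotomicExtension {p ^ 2} ℚ C] {s : K} (hs : s ^ 2 = 2) {x y r : ℤ}
    (hxy : x ^ 2 - 2 * y ^ 2 = p) (hx : IsCoprime (p : ℤ) (2 * x))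
    (hr : (p : ℤ) ^ 2 ∣ r ^ 2 - 2) (hu : (3 + 2 * r : ZMod (p ^ 2)) ^ (p - 1) = 1)
    (hπ : (x + y * r : ZMod (p ^ 2)) ^ (2 * (p - 1)) ≠ 1)
    (hπp : IsCoprime (p : ℤ) (x + y * r)) :
    p ∣ Nat.card (ClassGroup (𝓞 L)) := by
  by_contra hcard
  have hp' : p.Prime := Fact.out
  have hodd : Odd p := hp'.odd_of_ne_two hp
  have hdisj : K.LinearDisjoint F := .of_finrank_coprime (by
    rw [hK, hF]
    exact hodd.coprime_two_left)
  have hKL : Module.finrank K L = p :=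
    (finrank_eq_of_sup_eq_top (sup_comm K F ▸ hKF) hdisj.symm).trans hF
  have hsint : IsIntegral ℤ s :=
    .of_pow two_pos (by simpa [hs] using isIntegral_algebraMap (R := ℤ) (A := K) (x := 2))
  obtain ⟨s, rfl⟩ : ∃ t : 𝓞 K, algebraMap (𝓞 K) K t = s := ⟨⟨s, hsint⟩, rfl⟩
  have hs' : s * s = ((2 : ℤ) : 𝓞 K) := by
    apply RingOfIntegers.ext
    change algebraMap (𝓞 K) K _ = algebraMap (𝓞 K) K _
    rw [map_mul, map_intCast, ← sq, hs, Int.cast_ofNat]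
  let ψ : ℤ√2 →+* 𝓞 K := Zsqrtd.lift ⟨s, hs'⟩
  let π : ℤ√2 := ⟨x, y⟩
  have hππ : π * star π = (p : ℤ) := by
    rw [← Zsqrtd.norm_eq_mul_conj, ← hxy, Zsqrtd.norm_def]
    congr 1
    simp only [π]
    ring
  have hcop : IsCoprime π (star π) := by
    have h := hx.map (Int.castRingHom (ℤ√2))
    have h2 : Int.castRingHom (ℤ√2) (2 * x) = star π + π * 1 := by
      ext
      · simpa [π] using two_mul x
      · simp [π]
    rw [h2, eq_intCast, ← hππ] at h
    exact h.of_mul_left_left.of_add_mul_left_right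
  obtain ⟨w, hw⟩ := exists_pow_associated (C := C) hF
  let ι := (algebraMap (𝓞 K) (𝓞 L)).comp ψ
  obtain ⟨I, hI⟩ : ∃ I : Ideal (𝓞 L), Ideal.span {ι π} = I ^ p := by
    let : GCDMonoid (Ideal (𝓞 L)) := UniqueFactorizationMonoid.toGCDMonoid _
    refine exists_eq_pow_of_mul_eq_pow_of_coprime
      (b := Ideal.span {ι (star π)}) (c := Ideal.span {algebraMap (𝓞 F) (𝓞 L) w}) ?_ ?_
    · rw [Ideal.isCoprime_span_singleton_iff]
      exact hcop.map ι
    · rw [Ideal.span_singleton_mul_span_singleton, Ideal.span_singleton_pow,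
        Ideal.span_singleton_eq_span_singleton, ← map_mul, hππ]
      simpa using (hw.map (algebraMap (𝓞 F) (𝓞 L))).symm
  have hI0 : I ≠ 0 := by
    rintro rfl
    rw [zero_pow hp'.ne_zero, Ideal.zero_eq_bot, Ideal.span_singleton_eq_bot] at hI
    have h := congrArg ι hππ
    rw [map_mul, hI, zero_mul, map_intCast] at h
    exact hp'.ne_zero (by simpa using h.symm)
  have hIpr : I.IsPrincipal := by
    rw [← ClassGroup.mk0_eq_one_iff (mem_nonZeroDivisors_of_ne_zero hI0)]
    rw [← orderOf_eq_one_iff]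
    have h1 : orderOf (ClassGroup.mk0 ⟨I, mem_nonZeroDivisors_of_ne_zero hI0⟩) ∣ p := by
      rw [orderOf_dvd_iff_pow_eq_one, ← map_pow]
      refine (ClassGroup.mk0_eq_one_iff (pow_mem (mem_nonZeroDivisors_of_ne_zero hI0) p)).mpr ?_
      rw [← hI]
      exact ⟨_, rfl⟩
    refine ((Nat.dvd_prime hp').mp h1).resolve_right fun h ↦ hcard ?_
    rw [← h]
    exact orderOf_dvd_natCard _
  obtain ⟨α, rfl⟩ := hIpr
  have hα : Associated (ι π) (α ^ p) := by
    rw [← Ideal.span_singleton_eq_span_singleton, hI, ← Ideal.span_singleton_pow]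
  have hν : Associated (ψ π) (RingOfIntegers.norm K α) := by
    rw [← Associated.pow_iff hp'.ne_zero, ← map_pow (RingOfIntegers.norm K)]
    have h := hα.map (RingOfIntegers.norm K)
    have h2 := RingOfIntegers.norm_algebraMap (L := L) K (ψ π)
    rw [hKL] at h2
    exact h2 ▸ h
  obtain ⟨v, hv⟩ := hν
  obtain ⟨u, hu1, huv⟩ := Zsqrtd.exists_isUnit_lift_eq hK hs' v
  have hz : RingOfIntegers.norm K (4 * α) = ψ (4 ^ p * (π * u)) := by
    have h2 := RingOfIntegers.norm_algebraMap (L := L) K 4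
    rw [hKL, map_ofNat] at h2
    rw [map_mul, h2, ← hv, map_mul, map_mul, huv, map_pow, map_ofNat]
  obtain ⟨t, ht⟩ := exists_norm_intCast_congr K F hKF hK (hF ▸ hodd) hs'
    (n := (p : ℤ) ^ 2) (Nat.isCoprime_iff_coprime.mpr (hodd.coprime_two_right.pow_left 2)) hr α _ hz
  have hrr : (r : ZMod (p ^ 2)) * r = ((2 : ℤ) : ZMod (p ^ 2)) := by
    rw [← Int.cast_mul, eq_comm, ZMod.intCast_eq_intCast_iff_dvd_sub, ← sq]
    exact_mod_cast hr
  let φ : ℤ√2 →+* ZMod (p ^ 2) := Zsqrtd.lift ⟨r, hrr⟩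
  have hφ (z : ℤ√2) : φ z = z.re + z.im * r := Zsqrtd.lift_apply_apply ..
  have hφπ : φ π = x + y * r := hφ π
  have hφt : φ (4 ^ p * (π * u)) = (Algebra.norm ℤ t : ℤ) := by
    rw [hφ, eq_comm, mul_comm _ (r : ZMod (p ^ 2)), ← Int.cast_mul, ← Int.cast_add,
      ZMod.intCast_eq_intCast_iff_dvd_sub]
    exact_mod_cast ht
  have h4 : IsUnit (4 : ZMod (p ^ 2)) := by
    have := (ZMod.coe_int_isUnit_iff_isCoprime 4 (p ^ 2)).mpr
      (Nat.isCoprime_iff_coprime.mpr (Nat.Coprime.pow_left 2 (hodd.coprime_two_right.pow_right 2)))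
    exact_mod_cast this
  have h4p : (4 : ZMod (p ^ 2)) ^ (p * (p - 1)) = 1 := by
    obtain ⟨a, ha⟩ := h4
    have := congrArg Units.val (ZMod.pow_totient a)
    rwa [Nat.totient_prime_pow_succ hp', Units.val_pow_eq_pow_val, ha, pow_one] at this
  have hπunit : IsUnit (φ π) := by
    have := (ZMod.coe_int_isUnit_iff_isCoprime (x + y * r) (p ^ 2)).mpr (by
      push_cast
      exact hπp.pow_left)
    rw [hφπ]
    exact_mod_cast this
  have htp : IsCoprime (Algebra.norm ℤ t) p := by
    have h : IsUnit (φ (4 ^ p * (π * u))) := by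
      rw [map_mul, map_mul, map_pow, map_ofNat]
      exact (h4.pow p).mul (hπunit.mul (hu1.map φ))
    rw [hφt, ZMod.coe_int_isUnit_iff_isCoprime] at h
    push_cast at h
    exact ((IsCoprime.pow_left_iff two_pos).mp h).symm
  have ht1 : φ (4 ^ p * (π * u)) ^ (p - 1) = 1 := by
    have h := (ZMod.intCast_eq_intCast_iff _ _ _).mpr (norm_pow_modEq_one (C := C) hp hF t htp)
    rw [hφt]
    exact_mod_cast h
  have hu2 : φ u ^ (2 * (p - 1)) = 1 :=
    Zsqrtd.map_pow_eq_one_of_isUnit φ (hp'.even_sub_one hp) (by simpa [hφ] using hu) hu1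
  apply hπ
  rw [← hφπ]
  calc φ π ^ (2 * (p - 1))
    _ = (4 ^ (p * (p - 1))) ^ 2 * φ π ^ (2 * (p - 1)) * φ u ^ (2 * (p - 1)) := by
        rw [h4p, hu2, one_pow, one_mul, mul_one]
    _ = (φ (4 ^ p * (π * u)) ^ (p - 1)) ^ 2 := by
        rw [map_mul, map_mul, map_pow, map_ofNat]
        ring
    _ = 1 := by rw [ht1, one_pow]

/-- `1546463` divides the class number of the compositum `ℚ(√2)·ℚ(1546463)`, where `ℚ(1546463)` is the
unique degree-`1546463` subfield of `ℚ(ζ_{1546463²})` (the first layer of the cyclotomic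
`ℤ_1546463`-extension of `ℚ`), the compositum being taken inside `ℂ`. -/
theorem bigprime_dvd_classNumber
    (K₁ K₂ : IntermediateField ℚ ℂ)
    (hK₁ : K₁ = IntermediateField.adjoin ℚ {((Real.sqrt 2 : ℝ) : ℂ)})
    (ζ : ℂ) (hζ : IsPrimitiveRoot ζ (1546463 ^ 2))
    (hK₂sub : K₂ ≤ IntermediateField.adjoin ℚ {ζ})
    (hK₂deg : Module.finrank ℚ K₂ = 1546463) :
    1546463 ∣ Nat.card (ClassGroup (𝓞 ↥(K₁ ⊔ K₂))) := by
  have : Fact (Nat.Prime 1546463) := ⟨by norm_num⟩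
  have : NeZero (1546463 ^ 2) := ⟨by norm_num⟩
  let C := IntermediateField.adjoin ℚ {ζ}
  have : IsCyclotomicExtension {1546463 ^ 2} ℚ C := by
    change IsCyclotomicExtension {1546463 ^ 2} ℚ (IntermediateField.adjoin ℚ {ζ}).toSubalgebra
    rw [IntermediateField.adjoin_simple_toSubalgebra_of_isAlgebraic
      (hζ.isIntegral (by norm_num)).tower_top.isAlgebraic]
    exact hζ.adjoin_isCyclotomicExtension ℚ
  have : NumberField C := IsCyclotomicExtension.numberField {1546463 ^ 2} ℚ C
  have hs : ((Real.sqrt 2 : ℝ) : ℂ) ^ 2 = 2 := by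
    rw [← Complex.ofReal_pow, Real.sq_sqrt zero_le_two, Complex.ofReal_ofNat]
  have hK₁deg : Module.finrank ℚ K₁ = 2 := by
    rw [hK₁, finrank_adjoin_eq_two_of_sq_eq_two hs]
  have hsK₁ : ((Real.sqrt 2 : ℝ) : ℂ) ∈ K₁ := hK₁ ▸ IntermediateField.mem_adjoin_simple_self ℚ _
  have : FiniteDimensional ℚ K₁ := Module.finite_of_finrank_pos (by omega)
  have : FiniteDimensional ℚ K₂ := Module.finite_of_finrank_pos (by omega)
  have : NumberField ↥(K₁ ⊔ K₂) := {}
  let K := IntermediateField.restrict (le_sup_left : K₁ ≤ K₁ ⊔ K₂)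
  let F := IntermediateField.restrict (le_sup_right : K₂ ≤ K₁ ⊔ K₂)
  have hKF : K ⊔ F = ⊤ := by
    rw [← IntermediateField.lift_inj, IntermediateField.lift_top, IntermediateField.lift_sup,
      IntermediateField.lift_restrict, IntermediateField.lift_restrict]
  let : Algebra F C := ((IntermediateField.inclusion hK₂sub).comp
    (IntermediateField.restrictAlgEquiv le_sup_right).symm.toAlgHom).toRingHom.toAlgebra
  have hK : Module.finrank ℚ K = 2 :=
    (IntermediateField.restrictAlgEquiv le_sup_left).toLinearEquiv.finrank_eq.symm.trans hK₁deg
  have hF : Module.finrank ℚ F = 1546463 :=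
    (IntermediateField.restrictAlgEquiv le_sup_right).toLinearEquiv.finrank_eq.symm.trans hK₂deg
  refine dvd_card_classGroup (C := C) (by norm_num) K F hKF hK hF
    (s := IntermediateField.restrictAlgEquiv le_sup_left ⟨_, hsK₁⟩) ?_
    (x := 1601) (y := 713) (r := 1278700902452) (by norm_num) (by norm_num) (by norm_num) ?_ ?_ ?_
  · rw [← map_pow, show (⟨_, hsK₁⟩ : K₁) ^ 2 = 2 from Subtype.ext hs, map_ofNat]
  · rw [show 1546463 ^ 2 = 2391547810369 by norm_num, show 1546463 - 1 = 1546462 by norm_num]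
    push_cast
    reduce_mod_char
  · rw [show 1546463 ^ 2 = 2391547810369 by norm_num,
      show 2 * (1546463 - 1) = 3092924 by norm_num]
    push_cast
    reduce_mod_char
    decide
  · norm_num
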